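/- arXiv:2407.14652 — 2 statements merged into one kernel-verified Lean document; each statement's English description precedes it below -/
import Mathlib

section
/- Let n ≥ 1, k ∈ [n], and let u be a minimal-length representative of a coset of S_{n,ϖ_k} in S_n, with a reduced expression u = s_{i₁}⋯s_{i_ℓ}. Then for every j ∈ [ℓ], the inner product (s_{i_{j+1}}⋯s_{i_ℓ} ϖ_k , α_{i_j}) equals 1. -/
set_option maxHeartbeats 1000000

attribute [local instance] Classical.propDecidable

noncomputable section

namespace HLHecke

/-- The base ring `ℤ[t^{±1}]` of Laurent polynomials. -/
abbrev HR : Type := LaurentPolynomial ℤ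

/-- The parameter `t`. -/
def tt : HR := LaurentPolynomial.T 1

/-! ### The symmetric group on `Fin n` -/

/-- The simple transposition `s_j = (j, j+1)` (junk value `1` if out of range). -/
def sgen (n : ℕ) (j : ℕ) : Equiv.Perm (Fin n) :=
  if h : j + 1 < n then Equiv.swap ⟨j, Nat.lt_of_succ_lt h⟩ ⟨j + 1, h⟩ else 1

/-- The product `s_{i₁} ⋯ s_{i_ℓ}` of a word `l = [i₁, …, i_ℓ]`. -/
def wordProd (n : ℕ) (l : List ℕ) : Equiv.Perm (Fin n) := (l.map (sgen n)).prod

/-- The action of `S_n` on `ℤⁿ` by permutation of coordinates. -/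
def wAct (n : ℕ) (w : Equiv.Perm (Fin n)) (μ : Fin n → ℤ) : Fin n → ℤ := fun i => μ (w⁻¹ i)

/-- The standard inner product on `ℤⁿ`. -/
def ip (n : ℕ) (μ ν : Fin n → ℤ) : ℤ := ∑ i, μ i * ν i

/-- The standard basis vector `ε_i`. -/
def eps (n : ℕ) (i : Fin n) : Fin n → ℤ := fun k => if k = i then 1 else 0

/-- The simple root `α_j = ε_j − ε_{j+1}` (0-indexed: entries `j` and `j+1` of `Fin n`). -/
def alpha (n : ℕ) (j : ℕ) : Fin n → ℤ :=
  fun i => if (i : ℕ) = j then 1 else if (i : ℕ) = j + 1 then -1 else 0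

/-- The fundamental weight `ϖ_k = ε₁ + … + ε_k`. -/
def varpi (n : ℕ) (k : ℕ) : Fin n → ℤ := fun i => if (i : ℕ) < k then 1 else 0

/-- The set of positive roots `R₊`. -/
def Rpos (n : ℕ) (β : Fin n → ℤ) : Prop := ∃ i j : Fin n, i < j ∧ β = eps n i - eps n j

/-- The Coxeter length: minimal length of a word in the simple transpositions. -/
def len (n : ℕ) (w : Equiv.Perm (Fin n)) : ℕ :=
  sInf {k | ∃ l : List ℕ, (∀ j ∈ l, j + 1 < n) ∧ l.length = k ∧ wordProd n l = w}

/-- A choice of reduced word for `w`. -/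
def redWord (n : ℕ) (w : Equiv.Perm (Fin n)) : List ℕ :=
  if h : ∃ l : List ℕ, (∀ j ∈ l, j + 1 < n) ∧ l.length = len n w ∧ wordProd n l = w
  then h.choose else []

/-! ### Columns -/

lemma col_card_le (n : ℕ) (C : Finset (Fin n)) : C.card ≤ n := by
  simpa using Finset.card_le_univ C

/-- The minimal length coset representative `u_C` attached to a column `C`:
it sends `1, …, ℓ` to the entries of `C` in increasing order and `ℓ+1, …, n` to the
entries of the complement of `C` in increasing order. -/
def colPerm (n : ℕ) (C : Finset (Fin n)) : Equiv.Perm (Fin n) :=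
  ((finCongr ((Nat.add_sub_cancel' (col_card_le n C)).symm)).trans
    finSumFinEquiv.symm).trans <|
  ((Equiv.sumCongr (C.orderIsoOfFin rfl).toEquiv
      ((Cᶜ.orderIsoOfFin (by simp [Finset.card_compl])).toEquiv)).trans <|
    (Equiv.sumCongr (Equiv.refl _) (Equiv.subtypeEquivRight (fun x => Finset.mem_compl))).trans
      (Equiv.sumCompl (fun x => x ∈ C)))

/-- The `k`-th smallest entry of a column (0-indexed, as a natural number; junk `0` if
out of range). -/
def nth (n : ℕ) (C : Finset (Fin n)) (k : ℕ) : ℕ := ((C.sort (· ≤ ·)).map Fin.val).getD k 0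

/-- The action of the simple transposition `s_j` on columns. -/
def sCol (n : ℕ) (j : ℕ) (C : Finset (Fin n)) : Finset (Fin n) := C.image (sgen n j)

/-- Semistandardness of the two-column filling `F ⊗ E` (`F` the left column):
entrywise `f_i ≤ e_i`. -/
def pairSS (n : ℕ) (F E : Finset (Fin n)) : Prop := ∀ k < E.card, nth n F k ≤ nth n E k

/-- A filling by columns (leftmost column first) is semistandard iff all adjacent pairs are. -/
def isSSYT (n : ℕ) (L : List (Finset (Fin n))) : Prop := L.Chain' (pairSS n)

/-- The set `B(ϖ_ℓ)` of columns of length `ℓ`. -/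
def colFinset (n : ℕ) (ℓ : ℕ) : Finset (Finset (Fin n)) := Finset.univ.filter fun C => C.card = ℓ

/-- The highest weight column `(1, …, k)`. -/
def hwCol (n : ℕ) (k : ℕ) : Finset (Fin n) := Finset.univ.filter fun x => (x : ℕ) < k

/-- The vector `⃗C ∈ ℤⁿ` attached to a column `C`. -/
def vecOf (n : ℕ) (C : Finset (Fin n)) : Fin n → ℤ := fun i => if i ∈ C then 1 else 0

/-- The sign `σ^j_C`: `-1` if `j ∈ C` and `j+1 ∉ C`, and `+1` otherwise. -/
def sigmaSign (n : ℕ) (j : ℕ) (C : Finset (Fin n)) : ℤ :=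
  if h : j + 1 < n then
    (if (⟨j, Nat.lt_of_succ_lt h⟩ : Fin n) ∈ C ∧ (⟨j + 1, h⟩ : Fin n) ∉ C then -1 else 1)
  else 1

/-! ### Shapes and tableaux -/

/-- The length `λ'_{j+1}` of the `(j+1)`-st column (0-indexed `j`) of the Young diagram
of a partition `λ`. -/
def shapeColLen (n : ℕ) (μ : Fin n → ℤ) (j : ℕ) : ℕ :=
  (Finset.univ.filter fun i : Fin n => (j : ℤ) < μ i).card

/-- The number of columns of the Young diagram of a dominant weight. -/
def numCols (n : ℕ) (μ : Fin n → ℤ) : ℕ := Finset.univ.sup fun i : Fin n => (μ i).toNat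

/-- The highest weight tableau `T⁰_μ`: row `i` is filled with `i`, i.e. its columns are the
highest weight columns. -/
def hwTableau (n : ℕ) (μ : Fin n → ℤ) : List (Finset (Fin n)) :=
  List.ofFn fun j : Fin (numCols n μ) => hwCol n (shapeColLen n μ (j : ℕ))

/-- The content vector of a tableau: `(wtVec T) i` is the number of entries equal to `i`. -/
def wtVec (n : ℕ) (L : List (Finset (Fin n))) : Fin n → ℤ :=
  fun i => ((L.filter fun C => i ∈ C).length : ℤ)

/-! ### Macdonald's ψ statistic -/

/-- Number of entries `≤ i` in the column at position `p` (0-indexed from the left). -/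
def colCount (n : ℕ) (L : List (Finset (Fin n))) (i p : ℕ) : ℕ :=
  ((L.getD p ∅).filter fun x => (x : ℕ) < i).card

/-- The factor `ψ_{T_{≤ i+1}/T_{≤ i}}` of Macdonald's ψ. -/
def stripFactor (n : ℕ) (L : List (Finset (Fin n))) (i : ℕ) : HR :=
  ∏ p ∈ Finset.range L.length,
    if colCount n L (i + 1) p = colCount n L i p ∧
        colCount n L (i + 1) (p + 1) = colCount n L i (p + 1) + 1 then
      1 - tt ^ (colCount n L i p - colCount n L i (p + 1))
    else 1

/-- Macdonald's `ψ_T = ∏_{i=1}^{n-1} ψ_{T_{≤ i+1}/T_{≤ i}}` for a semistandard tableau. -/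
def macPsi (n : ℕ) (L : List (Finset (Fin n))) : HR := ∏ i ∈ Finset.Ico 1 n, stripFactor n L i

/-- Macdonald's tableau statistic, extended by `0` to non-semistandard fillings. -/
def psiT (n : ℕ) (L : List (Finset (Fin n))) : HR := if isSSYT n L then macPsi n L else 0

/-! ### The affine Hecke algebra -/

/-- Generators of the affine Hecke algebra. -/
inductive AGen (n : ℕ) : Type
  | T : ℕ → AGen n
  | X : Fin n → AGen n
  | Xinv : Fin n → AGen n

/-- The free algebra on the generators. -/
abbrev FA (n : ℕ) := FreeAlgebra HR (AGen n)

def fT (n : ℕ) (j : ℕ) : FA n := FreeAlgebra.ι HR (AGen.T j)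
def fX (n : ℕ) (i : Fin n) : FA n := FreeAlgebra.ι HR (AGen.X i)
def fXi (n : ℕ) (i : Fin n) : FA n := FreeAlgebra.ι HR (AGen.Xinv i)

/-- The defining relations of the type `GL_n` affine Hecke algebra. -/
inductive ARel (n : ℕ) : FA n → FA n → Prop
  | junk (j : ℕ) (h : ¬ j + 1 < n) : ARel n (fT n j) 1
  | quad (j : ℕ) (h : j + 1 < n) :
      ARel n (fT n j * fT n j) ((tt - 1) • fT n j + algebraMap HR (FA n) tt)
  | braid (j : ℕ) (h : j + 2 < n) :
      ARel n (fT n j * fT n (j + 1) * fT n j) (fT n (j + 1) * fT n j * fT n (j + 1))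
  | commT (j k : ℕ) (hjk : j + 1 < k) (hk : k + 1 < n) :
      ARel n (fT n j * fT n k) (fT n k * fT n j)
  | commX (i i' : Fin n) : ARel n (fX n i * fX n i') (fX n i' * fX n i)
  | XinvL (i : Fin n) : ARel n (fX n i * fXi n i) 1
  | XinvR (i : Fin n) : ARel n (fXi n i * fX n i) 1
  | TXT (j : ℕ) (h : j + 1 < n) :
      ARel n (fT n j * fX n ⟨j, Nat.lt_of_succ_lt h⟩ * fT n j) (tt • fX n ⟨j + 1, h⟩)
  | TXcomm (j : ℕ) (h : j + 1 < n) (i : Fin n) (hi1 : (i : ℕ) ≠ j) (hi2 : (i : ℕ) ≠ j + 1) :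
      ARel n (fT n j * fX n i) (fX n i * fT n j)

/-- The type `GL_n` affine Hecke algebra. -/
abbrev H (n : ℕ) := RingQuot (ARel n)

/-- The generator `T_j` of the (affine) Hecke algebra. -/
def Tg (n : ℕ) (j : ℕ) : H n := RingQuot.mkAlgHom HR (ARel n) (fT n j)

/-- The generator `X_i`. -/
def Xg (n : ℕ) (i : Fin n) : H n := RingQuot.mkAlgHom HR (ARel n) (fX n i)

/-- The generator `X_i⁻¹`. -/
def Xig (n : ℕ) (i : Fin n) : H n := RingQuot.mkAlgHom HR (ARel n) (fXi n i)

/-- The scalar `t` inside `H`. -/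
def tH (n : ℕ) : H n := algebraMap HR (H n) tt

/-- The scalar `t^k` inside `H`. -/
def tpow (n : ℕ) (k : ℕ) : H n := algebraMap HR (H n) (tt ^ k)

/-- The monomial `X^μ` for `μ ∈ ℤⁿ`. -/
def Xmon (n : ℕ) (μ : Fin n → ℤ) : H n :=
  (List.ofFn fun i : Fin n =>
    if 0 ≤ μ i then Xg n i ^ (μ i).toNat else Xig n i ^ (-μ i).toNat).prod

/-- The product `T_{i₁} ⋯ T_{i_ℓ}` of a word. -/
def TofWord (n : ℕ) (l : List ℕ) : H n := (l.map (Tg n)).prod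

/-- The element `T_w`, defined via a choice of reduced word for `w`. -/
def Tw (n : ℕ) (w : Equiv.Perm (Fin n)) : H n := TofWord n (redWord n w)

/-- The finite Hecke symmetrizer `1₀ = Σ_{w ∈ S_n} T_w`. -/
def one0 (n : ℕ) : H n := ∑ w : Equiv.Perm (Fin n), Tw n w

/-- The stabilizer `S_{n,λ}` as a finset. -/
def stabFinset (n : ℕ) (lam : Fin n → ℤ) : Finset (Equiv.Perm (Fin n)) :=
  Finset.univ.filter fun w => wAct n w lam = lam

/-- The parabolic symmetrizer `1_λ = Σ_{w ∈ S_{n,λ}} T_w`. -/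
def onePara (n : ℕ) (lam : Fin n → ℤ) : H n := ∑ w ∈ stabFinset n lam, Tw n w

/-- The Poincaré polynomial `W_λ(t) = Σ_{w ∈ S_{n,λ}} t^{ℓ(w)}`. -/
def Wlam (n : ℕ) (lam : Fin n → ℤ) : HR := ∑ w ∈ stabFinset n lam, tt ^ len n w

/-- The parabolic subalgebra `H_{n,λ}`, as the span of `{T_w : w ∈ S_{n,λ}}`. -/
def HparaM (n : ℕ) (lam : Fin n → ℤ) : Submodule HR (H n) :=
  Submodule.span HR (Tw n '' {w | wAct n w lam = lam})

/-- The finite Hecke algebra `H_n`, the subalgebra generated by the `T_j`. -/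
def Hfin (n : ℕ) : Subalgebra HR (H n) := Algebra.adjoin HR (Set.range (Tg n))

/-- The coefficient `h_{C, S}` of the parabolic decomposition
`h = Σ_{F ∈ B(ϖ_ℓ)} T_{u_F} h_F` (defined via choice; it is unique). -/
def paraCoeff (n : ℕ) (ℓ : ℕ) (h : H n) (C : Finset (Fin n)) : H n :=
  if hex : ∃ g : Finset (Fin n) → H n,
      (∀ F : Finset (Fin n), F.card = ℓ → g F ∈ HparaM n (varpi n ℓ)) ∧
      h = ∑ F ∈ colFinset n ℓ, Tw n (colPerm n F) * g F
  then hex.choose C else 0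

/-- The elements `Ψ_T` of the finite Hecke algebra, defined by recursion on the columns of `T`
(leftmost column first).  By convention `Ψ` of the empty tableau is `1₀`. -/
def Psi (n : ℕ) : List (Finset (Fin n)) → H n
  | [] => one0 n
  | [C] => tpow n (len n (colPerm n C)) * Ring.inverse (Tw n (colPerm n C)⁻¹) *
      onePara n (varpi n C.card)
  | C :: S => tpow n (len n (colPerm n C)) * Ring.inverse (Tw n (colPerm n C)⁻¹) *
      paraCoeff n C.card (Psi n S) C

end HLHecke
namespace HLHecke

/-- position statistic -/
def posN (n : ℕ) (μ : Fin n → ℤ) : ℤ := ∑ i : Fin n, ((i : ℕ) : ℤ) * μ i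

lemma wAct_one (n : ℕ) (μ : Fin n → ℤ) : wAct n 1 μ = μ := by
  funext i; simp [wAct]

lemma wAct_mul (n : ℕ) (v w : Equiv.Perm (Fin n)) (μ : Fin n → ℤ) :
    wAct n (v * w) μ = wAct n v (wAct n w μ) := by
  funext i; simp [wAct, mul_inv_rev]

lemma wordProd_cons (n i : ℕ) (l : List ℕ) :
    wordProd n (i :: l) = sgen n i * wordProd n l := by
  simp [wordProd]

lemma posN_sgen (n i : ℕ) (hi : i + 1 < n) (μ : Fin n → ℤ) :
    posN n (wAct n (sgen n i) μ) = posN n μ + ip n μ (alpha n i) := by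
  have h1 : posN n (wAct n (sgen n i) μ) = ∑ x : Fin n, ((sgen n i x : ℕ) : ℤ) * μ x := by
    unfold posN wAct
    exact (Equiv.sum_comp (sgen n i) _).symm.trans (by simp)
  rw [h1, posN, ip, ← Finset.sum_add_distrib]
  refine Finset.sum_congr rfl fun x _ => ?_
  have : ((sgen n i x : ℕ) : ℤ) = (x : ℕ) + alpha n i x := by
    simp only [sgen, hi, dif_pos, alpha, Equiv.swap_apply_def, Fin.ext_iff]
    split_ifs <;> simp_all
  rw [this]; ring

lemma ip_alpha (n i : ℕ) (hi : i + 1 < n) (μ : Fin n → ℤ) :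
    ip n μ (alpha n i) = μ ⟨i, Nat.lt_of_succ_lt hi⟩ - μ ⟨i + 1, hi⟩ := by
  have : ∀ x : Fin n, μ x * alpha n i x =
      (if x = ⟨i, Nat.lt_of_succ_lt hi⟩ then μ x else 0) - (if x = ⟨i + 1, hi⟩ then μ x else 0) := by
    intro x
    simp only [alpha, Fin.ext_iff]
    split_ifs <;> first | omega | simp
  simp only [ip, this, Finset.sum_sub_distrib]
  simp

lemma val01 (n k : ℕ) (w : Equiv.Perm (Fin n)) (x : Fin n) :
    wAct n w (varpi n k) x = 0 ∨ wAct n w (varpi n k) x = 1 := by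
  simp only [wAct, varpi]; split_ifs <;> simp

lemma ip_le (n k i : ℕ) (hi : i + 1 < n) (w : Equiv.Perm (Fin n)) :
    ip n (wAct n w (varpi n k)) (alpha n i) ≤ 1 := by
  rw [ip_alpha n i hi]
  have h1 := val01 n k w ⟨i, Nat.lt_of_succ_lt hi⟩
  have h2 := val01 n k w ⟨i + 1, hi⟩
  omega

lemma posN_append (n k : ℕ) (l₁ l₂ : List ℕ) (h : ∀ j ∈ l₁, j + 1 < n) :
    posN n (wAct n (wordProd n (l₁ ++ l₂)) (varpi n k)) ≤
      posN n (wAct n (wordProd n l₂) (varpi n k)) + l₁.length := by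
  induction l₁ with
  | nil => simp
  | cons a t ih =>
    have ih' := ih (fun j hj => h j (List.mem_cons_of_mem _ hj))
    have ha := h a List.mem_cons_self
    rw [List.cons_append, wordProd_cons, wAct_mul, posN_sgen n a ha]
    have := ip_le n k a ha (wordProd n (t ++ l₂))
    push_cast [List.length_cons]
    linarith

lemma posN_nonneg (n k : ℕ) (w : Equiv.Perm (Fin n)) :
    0 ≤ posN n (wAct n w (varpi n k)) := by
  refine Finset.sum_nonneg fun x _ => mul_nonneg (by positivity) ?_
  rcases val01 n k w x with h | h <;> simp [h]

lemma anti_eq (n k : ℕ) (w : Equiv.Perm (Fin n))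
    (h : ∀ i (hi : i + 1 < n), wAct n w (varpi n k) ⟨i + 1, hi⟩ ≤
      wAct n w (varpi n k) ⟨i, Nat.lt_of_succ_lt hi⟩) :
    wAct n w (varpi n k) = varpi n k := by
  have ha : Antitone (wAct n w (varpi n k)) := by
    cases n with
    | zero => intro x; exact x.elim0
    | succ m =>
      rw [Fin.antitone_iff_succ_le]
      intro i
      exact h i (by omega)
  have hb : Antitone (varpi n k) := by
    intro x y hxy
    have : (x : ℕ) ≤ y := hxy
    simp only [varpi]
    split_ifs <;> first | omega | simp
  exact Tuple.unique_antitone (f := varpi n k) (σ := w⁻¹) (τ := 1) ha hb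

lemma exists_word (n k : ℕ) (m : ℕ) : ∀ w : Equiv.Perm (Fin n),
    posN n (wAct n w (varpi n k)) ≤ m →
    ∃ l : List ℕ, (∀ j ∈ l, j + 1 < n) ∧
      wAct n (wordProd n l) (varpi n k) = wAct n w (varpi n k) ∧
      (l.length : ℤ) = posN n (wAct n w (varpi n k)) - posN n (varpi n k) := by
  induction m with
  | zero =>
    intro w hw
    by_cases h : ∀ i (hi : i + 1 < n), wAct n w (varpi n k) ⟨i + 1, hi⟩ ≤
      wAct n w (varpi n k) ⟨i, Nat.lt_of_succ_lt hi⟩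
    · have := anti_eq n k w h
      exact ⟨[], by simp, by rw [this]; simp [wordProd, wAct_one], by simp [this]⟩
    · exfalso
      push Not at h
      obtain ⟨i, hi, hlt⟩ := h
      have h1 := posN_sgen n i hi (wAct n w (varpi n k))
      rw [ip_alpha n i hi, ← wAct_mul] at h1
      have := posN_nonneg n k (sgen n i * w)
      push_cast at hw
      linarith
  | succ m ih =>
    intro w hw
    by_cases h : ∀ i (hi : i + 1 < n), wAct n w (varpi n k) ⟨i + 1, hi⟩ ≤
      wAct n w (varpi n k) ⟨i, Nat.lt_of_succ_lt hi⟩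
    · have := anti_eq n k w h
      exact ⟨[], by simp, by rw [this]; simp [wordProd, wAct_one], by simp [this]⟩
    · push Not at h
      obtain ⟨i, hi, hlt⟩ := h
      have h1 := posN_sgen n i hi (wAct n w (varpi n k))
      rw [ip_alpha n i hi, ← wAct_mul] at h1
      have e1 := val01 n k w ⟨i, Nat.lt_of_succ_lt hi⟩
      have e2 := val01 n k w ⟨i + 1, hi⟩
      push_cast at hw
      obtain ⟨l, hl1, hl2, hl3⟩ := ih (sgen n i * w) (by omega)
      refine ⟨i :: l, ?_, ?_, ?_⟩
      · intro j hj
        rcases List.mem_cons.1 hj with rfl | hj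
        · exact hi
        · exact hl1 j hj
      · rw [wordProd_cons, wAct_mul, hl2, ← wAct_mul, ← mul_assoc]
        have : sgen n i * sgen n i = 1 := by simp [sgen, hi]
        rw [this, one_mul]
      · push_cast [List.length_cons]
        omega

/-- if `u` is a minimal length coset representative of `S_n/S_{n,ϖ_k}` with a
reduced expression `u = s_{i₁} ⋯ s_{i_ℓ}`, then `(s_{i_{j+1}} ⋯ s_{i_ℓ} ϖ_k, α_{i_j}) = 1`
for every `j ∈ [ℓ]`. -/
theorem stmt1 (n k : ℕ) (hn : 1 ≤ n) (hk1 : 1 ≤ k) (hkn : k ≤ n)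
    (u : Equiv.Perm (Fin n))
    (hmin : ∀ v : Equiv.Perm (Fin n),
      wAct n (u⁻¹ * v) (varpi n k) = varpi n k → len n u ≤ len n v)
    (l : List ℕ) (hval : ∀ j ∈ l, j + 1 < n)
    (hprod : wordProd n l = u) (hred : l.length = len n u)
    (j : ℕ) (hj : j < l.length) :
    ip n (wAct n (wordProd n (l.drop (j + 1))) (varpi n k)) (alpha n (l.getD j 0)) = 1 := by
  have hact : ∀ v w : Equiv.Perm (Fin n), wAct n v (varpi n k) = wAct n w (varpi n k) →
      wAct n (w⁻¹ * v) (varpi n k) = varpi n k := by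
    intro v w h
    rw [wAct_mul, h, ← wAct_mul]
    simp [wAct_one]
  obtain ⟨l', h1, h2, h3⟩ := exists_word n k (posN n (wAct n u (varpi n k))).toNat u
    (Int.self_le_toNat _)
  have h4 := hmin _ (hact _ _ h2)
  have h5 : len n (wordProd n l') ≤ l'.length := Nat.sInf_le ⟨l', h1, rfl, rfl⟩
  have h6 : l = l.take j ++ l[j] :: l.drop (j + 1) := by simp
  have hi : l[j] + 1 < n := hval _ (List.getElem_mem hj)
  have h7 := posN_append n k (l.take j) (l[j] :: l.drop (j + 1))
    (fun x hx => hval x (List.mem_of_mem_take hx))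
  have h8 := posN_append n k (l.drop (j + 1)) []
    (fun x hx => hval x (List.mem_of_mem_drop hx))
  rw [← h6, hprod, wordProd_cons, wAct_mul, posN_sgen n _ hi] at h7
  have h9 : wAct n (wordProd n []) (varpi n k) = varpi n k := by simp [wordProd, wAct_one]
  rw [List.append_nil, h9] at h8
  have h10 := ip_le n k _ hi (wordProd n (l.drop (j + 1)))
  have h11 : l.getD j 0 = l[j] := by simp [hj]
  rw [h11]
  rw [List.length_take] at h7
  rw [List.length_drop] at h8
  omega

end HLHecke
end
end

section
/- Let n ≥ 1, k ∈ [n], and let I ∈ B(ϖ_k) be a column of length k. Then in the type GL_n affine Hecke algebra H, T_{u_I} X^{ϖ_k} = X^{⃗I} · t^{ℓ(u_I)} (T_{u_I⁻¹})⁻¹, where ⃗I = Σ_{i∈I} ε_i. -/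
set_option maxHeartbeats 1000000

attribute [local instance] Classical.propDecidable

noncomputable section

namespace HLHecke

lemma colPerm_lt (n : ℕ) (C : Finset (Fin n)) (x : Fin n) (h : (x : ℕ) < C.card) :
    colPerm n C x = C.orderEmbOfFin rfl ⟨x, h⟩ := by
  have : (finCongr ((Nat.add_sub_cancel' (col_card_le n C)).symm)) x
      = Fin.castAdd (n - C.card) ⟨x, h⟩ := by ext; simp
  simp only [colPerm, Equiv.trans_apply, this, finSumFinEquiv_symm_apply_castAdd]
  simp

lemma colPerm_ge (n : ℕ) (C : Finset (Fin n)) (x : Fin n) (h : C.card ≤ (x : ℕ)) :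
    colPerm n C x = Cᶜ.orderEmbOfFin (k := n - C.card) (by simp [Finset.card_compl])
      ⟨x - C.card, by omega⟩ := by
  have : (finCongr ((Nat.add_sub_cancel' (col_card_le n C)).symm)) x
      = Fin.natAdd C.card (⟨x - C.card, by omega⟩ : Fin (n - C.card)) := by
    ext; simp; omega
  simp only [colPerm, Equiv.trans_apply, this, finSumFinEquiv_symm_apply_natAdd]
  simp

lemma colPerm_unique (n : ℕ) (C : Finset (Fin n)) (w : Equiv.Perm (Fin n))
    (h1 : ∀ x : Fin n, (x : ℕ) < C.card → w x ∈ C)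
    (h2 : ∀ x : Fin n, C.card ≤ (x : ℕ) → w x ∉ C)
    (h3 : ∀ x y : Fin n, x < y → (y : ℕ) < C.card → w x < w y)
    (h4 : ∀ x y : Fin n, x < y → C.card ≤ (x : ℕ) → w x < w y) : w = colPerm n C := by
  have hc := col_card_le n C
  ext1 x
  rcases lt_or_ge (x : ℕ) C.card with h | h
  · rw [colPerm_lt n C x h]
    have := Finset.orderEmbOfFin_unique (s := C) rfl
      (f := fun y : Fin C.card => w ⟨y, by omega⟩)
      (fun y => h1 _ y.2) (fun a b hab => h3 _ _ (by simpa using hab) b.2)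
    exact congrFun this ⟨x, h⟩
  · rw [colPerm_ge n C x h]
    have := Finset.orderEmbOfFin_unique (s := Cᶜ) (k := n - C.card)
      (by simp [Finset.card_compl])
      (f := fun y : Fin (n - C.card) => w ⟨C.card + y, by omega⟩)
      (fun y => by
        rw [Finset.mem_compl]
        exact h2 _ (by simp))
      (fun a b hab => h4 _ _ (by simpa using hab) (by simp))
    have h5 := congrFun this ⟨x - C.card, by omega⟩
    rw [← h5]
    congr 1
    ext
    simp; omega

lemma colPerm_mem_iff (n : ℕ) (C : Finset (Fin n)) (x : Fin n) :
    colPerm n C x ∈ C ↔ (x : ℕ) < C.card := by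
  rcases lt_or_ge (x : ℕ) C.card with h | h
  · rw [colPerm_lt n C x h]; simp [h]
  · rw [colPerm_ge n C x h]
    have := Finset.orderEmbOfFin_mem Cᶜ (k := n - C.card) (by simp [Finset.card_compl])
      ⟨x - C.card, by omega⟩
    rw [Finset.mem_compl] at this
    simp [this, h]

lemma colPerm_mono1 (n : ℕ) (C : Finset (Fin n)) (x y : Fin n) (h : x < y)
    (hy : (y : ℕ) < C.card) : colPerm n C x < colPerm n C y := by
  have hx : (x : ℕ) < C.card := lt_trans h hy
  rw [colPerm_lt n C x hx, colPerm_lt n C y hy]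
  simpa using h

lemma colPerm_mono2 (n : ℕ) (C : Finset (Fin n)) (x y : Fin n) (h : x < y)
    (hx : C.card ≤ (x : ℕ)) : colPerm n C x < colPerm n C y := by
  have h' : (x : ℕ) < y := h
  rw [colPerm_ge n C x hx, colPerm_ge n C y (by omega)]
  simp only [OrderEmbedding.lt_iff_lt, Fin.mk_lt_mk]
  omega

lemma sgen_sgen (n i : ℕ) (x : Fin n) : sgen n i (sgen n i x) = x := by
  unfold sgen; split <;> simp

lemma sgen_mul_self (n i : ℕ) : sgen n i * sgen n i = 1 := by
  ext1 x; simp [sgen_sgen]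

lemma sgen_inv (n i : ℕ) : (sgen n i)⁻¹ = sgen n i := by
  rw [inv_eq_iff_mul_eq_one, sgen_mul_self]

lemma mem_sCol (n i : ℕ) (C : Finset (Fin n)) (x : Fin n) :
    x ∈ sCol n i C ↔ sgen n i x ∈ C := by
  unfold sCol
  rw [Finset.mem_image]
  constructor
  · rintro ⟨y, hy, rfl⟩; rwa [sgen_sgen]
  · intro h; exact ⟨_, h, sgen_sgen n i x⟩

lemma sCol_sCol (n i : ℕ) (C : Finset (Fin n)) : sCol n i (sCol n i C) = C := by
  ext x; rw [mem_sCol, mem_sCol, sgen_sgen]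

lemma card_sCol (n i : ℕ) (C : Finset (Fin n)) : (sCol n i C).card = C.card :=
  Finset.card_image_of_injective _ (sgen n i).injective

lemma sgen_val (n i : ℕ) (h : i + 1 < n) (x : Fin n) :
    ((sgen n i x : Fin n) : ℕ) = if (x : ℕ) = i then i + 1 else if (x : ℕ) = i + 1 then i else x := by
  unfold sgen
  rw [dif_pos h, Equiv.swap_apply_def]
  simp only [Fin.ext_iff]
  split_ifs <;> simp_all

/-- sum of entries -/
def csum (n : ℕ) (C : Finset (Fin n)) : ℕ := ∑ x ∈ C, (x : ℕ)

lemma csum_sCol (n i : ℕ) (C : Finset (Fin n)) :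
    csum n (sCol n i C) = ∑ x ∈ C, (sgen n i x : ℕ) := by
  unfold csum sCol
  rw [Finset.sum_image (fun a _ b _ h => (sgen n i).injective h)]

lemma csum_up (n i : ℕ) (h : i + 1 < n) (C : Finset (Fin n))
    (h1 : (⟨i, by omega⟩ : Fin n) ∈ C) (h2 : (⟨i + 1, h⟩ : Fin n) ∉ C) :
    csum n (sCol n i C) = csum n C + 1 := by
  rw [csum_sCol]
  unfold csum
  rw [← Finset.add_sum_erase _ _ h1, ← Finset.add_sum_erase C (fun x : Fin n => (x : ℕ)) h1]
  have : ∑ x ∈ C.erase ⟨i, by omega⟩, (sgen n i x : ℕ) = ∑ x ∈ C.erase ⟨i, by omega⟩, (x : ℕ) := by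
    apply Finset.sum_congr rfl
    intro x hx
    rw [Finset.mem_erase] at hx
    rw [sgen_val n i h, if_neg (fun e => hx.1 (Fin.ext e)),
      if_neg (fun e => h2 (by convert hx.2; exact e.symm))]
  rw [this, sgen_val n i h]
  simp; omega

lemma csum_le (n i : ℕ) (h : i + 1 < n) (C : Finset (Fin n))
    (h1 : ¬ ((⟨i, by omega⟩ : Fin n) ∈ C ∧ (⟨i + 1, h⟩ : Fin n) ∉ C)) :
    csum n (sCol n i C) ≤ csum n C := by
  by_cases h0 : (⟨i, by omega⟩ : Fin n) ∈ C
  · have h2 : (⟨i + 1, h⟩ : Fin n) ∈ C := by tauto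
    have : sCol n i C = C := by
      ext x
      rw [mem_sCol]
      by_cases e1 : (x : ℕ) = i
      · have : sgen n i x = ⟨i+1, h⟩ := by ext; rw [sgen_val n i h]; simp [e1]
        have e : x = ⟨i, Nat.lt_of_succ_lt h⟩ := Fin.ext e1
        rw [this]; subst e; tauto
      by_cases e2 : (x : ℕ) = i + 1
      · have : sgen n i x = ⟨i, Nat.lt_of_succ_lt h⟩ := by ext; rw [sgen_val n i h]; simp [e2]
        have e : x = ⟨i+1, h⟩ := Fin.ext e2
        rw [this]; subst e; tauto
      have : sgen n i x = x := by ext; rw [sgen_val n i h]; simp [e1, e2]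
      rw [this]
    rw [this]
  · rw [csum_sCol]
    apply Finset.sum_le_sum
    intro x hx
    rw [sgen_val n i h, if_neg (fun e => h0 (by convert hx; exact e.symm))]
    split_ifs <;> omega

/-- words climbing from the highest weight column -/
def Good (n k : ℕ) : List ℕ → Finset (Fin n) → Prop
  | [], C => C = hwCol n k
  | i :: l, C => ∃ h : i + 1 < n, (⟨i, by omega⟩ : Fin n) ∉ C ∧ (⟨i + 1, h⟩ : Fin n) ∈ C ∧
      Good n k l (sCol n i C)

lemma mem_hwCol (n k : ℕ) (x : Fin n) : x ∈ hwCol n k ↔ (x : ℕ) < k := by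
  simp [hwCol]

lemma card_hwCol (n k : ℕ) (h : k ≤ n) : (hwCol n k).card = k := by
  have : (hwCol n k) = Finset.univ.map (Fin.castLEEmb h) := by
    ext x
    rw [mem_hwCol]
    simp only [Finset.mem_map, Finset.mem_univ, true_and]
    constructor
    · intro hx; exact ⟨⟨x, hx⟩, rfl⟩
    · rintro ⟨y, rfl⟩; exact y.2
  rw [this]; simp

lemma sgen_at (n i : ℕ) (h : i + 1 < n) : sgen n i ⟨i, by omega⟩ = ⟨i + 1, h⟩ := by
  ext; rw [sgen_val n i h]; simp

lemma sgen_at' (n i : ℕ) (h : i + 1 < n) : sgen n i ⟨i + 1, h⟩ = ⟨i, by omega⟩ := by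
  ext; rw [sgen_val n i h]; simp

lemma csum_down (n i : ℕ) (h : i + 1 < n) (C : Finset (Fin n))
    (h1 : (⟨i, by omega⟩ : Fin n) ∉ C) (h2 : (⟨i + 1, h⟩ : Fin n) ∈ C) :
    csum n C = csum n (sCol n i C) + 1 := by
  have := csum_up n i h (sCol n i C) (by rwa [mem_sCol, sgen_at n i h])
    (by rwa [mem_sCol, sgen_at'])
  rwa [sCol_sCol] at this

lemma exists_step (n k : ℕ) (hk : k ≤ n) (C : Finset (Fin n)) (hC : C.card = k)
    (hne : C ≠ hwCol n k) :
    ∃ i, ∃ h : i + 1 < n, (⟨i, by omega⟩ : Fin n) ∉ C ∧ (⟨i + 1, h⟩ : Fin n) ∈ C := by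
  by_contra hcon
  push Not at hcon
  have down : ∀ d y : ℕ, ∀ h : y + d < n, (⟨y + d, h⟩ : Fin n) ∈ C →
      (⟨y, by omega⟩ : Fin n) ∈ C := by
    intro d
    induction d with
    | zero => intro y h hm; exact hm
    | succ d ih =>
      intro y h hm
      apply ih y (by omega)
      by_contra h'
      exact hcon (y + d) h h' hm
  apply hne
  apply Finset.eq_of_subset_of_card_le
  · intro x hx
    rw [mem_hwCol]
    have : hwCol n (x + 1) ⊆ C := by
      intro y hy
      rw [mem_hwCol] at hy
      have := down (x - y) y (by omega) (by convert hx; omega)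
      exact this
    have := Finset.card_le_card this
    rw [card_hwCol _ _ (by omega)] at this
    omega
  · rw [card_hwCol n k hk, hC]

lemma exists_good (n k : ℕ) (hk : k ≤ n) : ∀ (N : ℕ) (C : Finset (Fin n)), csum n C = N →
    C.card = k → ∃ l, Good n k l C := by
  intro N
  induction N using Nat.strong_induction_on with
  | _ N ih =>
  intro C hN hC
  by_cases hne : C = hwCol n k
  · exact ⟨[], hne⟩
  · obtain ⟨i, h, h1, h2⟩ := exists_step n k hk C hC hne
    have := csum_down n i h C h1 h2
    obtain ⟨l, hl⟩ := ih _ (by omega) (sCol n i C) rfl (by rw [card_sCol, hC])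
    exact ⟨i :: l, h, h1, h2, hl⟩

lemma colPerm_hw (n k : ℕ) (hk : k ≤ n) : colPerm n (hwCol n k) = 1 := by
  symm
  apply colPerm_unique
  all_goals simp only [card_hwCol n k hk, mem_hwCol, Equiv.Perm.coe_one, id]
  · exact fun x h => h
  · intro x h; omega
  · exact fun x y h _ => h
  · exact fun x y h _ => h

lemma colPerm_step (n i : ℕ) (h : i + 1 < n) (C : Finset (Fin n))
    (h1 : (⟨i, by omega⟩ : Fin n) ∉ C) (h2 : (⟨i + 1, h⟩ : Fin n) ∈ C) :
    sgen n i * colPerm n (sCol n i C) = colPerm n C := by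
  have e1 : (⟨i, by omega⟩ : Fin n) ∈ sCol n i C := by rwa [mem_sCol, sgen_at n i h]
  have e2 : (⟨i + 1, h⟩ : Fin n) ∉ sCol n i C := by rwa [mem_sCol, sgen_at']
  have key := fun x => (mem_sCol n i C (colPerm n (sCol n i C) x)).symm.trans
    (colPerm_mem_iff n (sCol n i C) x)
  have key2 := colPerm_mem_iff n (sCol n i C)
  have hlt : ∀ a b : Fin n, a < b → ¬ ((a : ℕ) = i ∧ (b : ℕ) = i + 1) →
      sgen n i a < sgen n i b := by
    intro a b hab hn
    rw [Fin.lt_def] at hab ⊢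
    rw [sgen_val n i h, sgen_val n i h]
    split_ifs <;> omega
  apply colPerm_unique
  · intro x hx
    rw [Equiv.Perm.mul_apply, key, card_sCol]; exact hx
  · intro x hx
    rw [Equiv.Perm.mul_apply, key, card_sCol]; omega
  · intro x y hxy hy
    apply hlt _ _ (colPerm_mono1 _ _ _ _ hxy (by rwa [card_sCol]))
    rintro ⟨_, hb⟩
    have := (key2 y).2 (by rwa [card_sCol])
    rw [show colPerm n (sCol n i C) y = ⟨i + 1, h⟩ from Fin.ext hb] at this
    exact e2 this
  · intro x y hxy hx
    apply hlt _ _ (colPerm_mono2 _ _ _ _ hxy (by rwa [card_sCol]))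
    rintro ⟨ha, _⟩
    have := (key2 x).not.2 (by rw [card_sCol]; omega)
    rw [show colPerm n (sCol n i C) x = ⟨i, by omega⟩ from Fin.ext ha] at this
    exact this e1

lemma Good.props (n k : ℕ) (hk : k ≤ n) : ∀ (l : List ℕ) (C : Finset (Fin n)), Good n k l C →
    (∀ j ∈ l, j + 1 < n) ∧ wordProd n l = colPerm n C ∧
      csum n C = csum n (hwCol n k) + l.length := by
  intro l
  induction l with
  | nil =>
    intro C hC
    have : C = hwCol n k := hC
    subst this
    simp [colPerm_hw n k hk, wordProd]
  | cons i l ih =>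
    rintro C ⟨h, h1, h2, hl⟩
    obtain ⟨a, b, c⟩ := ih _ hl
    refine ⟨by simpa [h] using a, ?_, ?_⟩
    · rw [← colPerm_step n i h C h1 h2, ← b]; simp [wordProd]
    · rw [csum_down n i h C h1 h2, c]; simp; omega

lemma word_bound (n k : ℕ) : ∀ l : List ℕ, (∀ j ∈ l, j + 1 < n) →
    csum n ((hwCol n k).image (wordProd n l)) ≤ csum n (hwCol n k) + l.length ∧
    (csum n ((hwCol n k).image (wordProd n l)) = csum n (hwCol n k) + l.length →
      Good n k l ((hwCol n k).image (wordProd n l))) := by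
  intro l
  induction l with
  | nil =>
    intro _
    simp [wordProd, Good]
  | cons i l ih =>
    intro hl
    have h : i + 1 < n := hl i (by simp)
    obtain ⟨a, b⟩ := ih (fun j hj => hl j (by simp [hj]))
    have e : (hwCol n k).image (wordProd n (i :: l))
        = sCol n i ((hwCol n k).image (wordProd n l)) := by
      unfold sCol
      rw [Finset.image_image]
      simp [wordProd]
    rw [e]
    generalize (hwCol n k).image (wordProd n l) = J at *
    simp only [List.length_cons]
    by_cases hJ : (⟨i, by omega⟩ : Fin n) ∈ J ∧ (⟨i + 1, h⟩ : Fin n) ∉ J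
    · have := csum_up n i h J hJ.1 hJ.2
      refine ⟨by omega, fun h' => ⟨h, ?_, ?_, ?_⟩⟩
      · rw [mem_sCol, sgen_at n i h]; exact hJ.2
      · rw [mem_sCol, sgen_at' n i h]; exact hJ.1
      · rw [sCol_sCol]; exact b (by omega)
    · have := csum_le n i h J hJ
      exact ⟨by omega, fun h' => by omega⟩

lemma image_colPerm (n k : ℕ) (hk : k ≤ n) (C : Finset (Fin n)) (hC : C.card = k) :
    (hwCol n k).image (colPerm n C) = C := by
  apply Finset.eq_of_subset_of_card_le
  · intro x hx
    rw [Finset.mem_image] at hx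
    obtain ⟨y, hy, rfl⟩ := hx
    rw [colPerm_mem_iff, hC]
    exact (mem_hwCol n k y).1 hy
  · rw [Finset.card_image_of_injective _ (colPerm n C).injective, card_hwCol n k hk, hC]

lemma wordProd_reverse (n : ℕ) (l : List ℕ) : wordProd n l.reverse = (wordProd n l)⁻¹ := by
  unfold wordProd
  rw [List.prod_inv_reverse, List.map_reverse, List.map_map]
  congr 3
  funext i
  simp [sgen_inv]

lemma good_of_word (n k : ℕ) (hk : k ≤ n) (C : Finset (Fin n)) (hC : C.card = k) (l : List ℕ)
    (hl : ∀ j ∈ l, j + 1 < n) (hw : wordProd n l = colPerm n C)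
    (hlen : csum n C = csum n (hwCol n k) + l.length) : Good n k l C := by
  have := (word_bound n k l hl).2
  rw [hw, image_colPerm n k hk C hC] at this
  exact this hlen

lemma len_colPerm (n k : ℕ) (hk : k ≤ n) (C : Finset (Fin n)) (hC : C.card = k) :
    csum n C = csum n (hwCol n k) + len n (colPerm n C) := by
  obtain ⟨l, hl⟩ := exists_good n k hk _ C rfl hC
  obtain ⟨a, b, c⟩ := Good.props n k hk l C hl
  have h1 : len n (colPerm n C) ≤ l.length := Nat.sInf_le ⟨l, a, rfl, b⟩
  have h2 : ∃ m : List ℕ, (∀ j ∈ m, j + 1 < n) ∧ m.length = len n (colPerm n C) ∧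
      wordProd n m = colPerm n C := Nat.sInf_mem
        (s := {k | ∃ l : List ℕ, (∀ j ∈ l, j + 1 < n) ∧ l.length = k ∧ wordProd n l = colPerm n C})
        ⟨_, l, a, rfl, b⟩
  obtain ⟨m, m1, m2, m3⟩ := h2
  have := (word_bound n k m m1).1
  rw [m3, image_colPerm n k hk C hC] at this
  omega

lemma len_inv (n : ℕ) (w : Equiv.Perm (Fin n)) : len n w⁻¹ = len n w := by
  unfold len
  congr 1
  ext k
  constructor
  · rintro ⟨l, a, b, c⟩
    exact ⟨l.reverse, by simpa using a, by simpa using b, by rw [wordProd_reverse, c, inv_inv]⟩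
  · rintro ⟨l, a, b, c⟩
    exact ⟨l.reverse, by simpa using a, by simpa using b, by rw [wordProd_reverse, c]⟩

lemma redWord_spec (n : ℕ) (w : Equiv.Perm (Fin n))
    (hw : ∃ l : List ℕ, (∀ j ∈ l, j + 1 < n) ∧ wordProd n l = w) :
    (∀ j ∈ redWord n w, j + 1 < n) ∧ (redWord n w).length = len n w ∧
      wordProd n (redWord n w) = w := by
  have h2 : ∃ m : List ℕ, (∀ j ∈ m, j + 1 < n) ∧ m.length = len n w ∧
      wordProd n m = w := Nat.sInf_mem
        (s := {k | ∃ l : List ℕ, (∀ j ∈ l, j + 1 < n) ∧ l.length = k ∧ wordProd n l = w})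
        (by obtain ⟨l, a, b⟩ := hw; exact ⟨_, l, a, rfl, b⟩)
  unfold redWord
  rw [dif_pos h2]
  exact h2.choose_spec

/-! Hecke algebra part -/

lemma TofWord_cons (n i : ℕ) (l : List ℕ) : TofWord n (i :: l) = Tg n i * TofWord n l := by
  simp [TofWord]

lemma TofWord_append (n : ℕ) (l m : List ℕ) :
    TofWord n (l ++ m) = TofWord n l * TofWord n m := by
  simp [TofWord]

lemma Tg_comm (n i j : ℕ) (hi : i + 1 < n) (hj : j + 1 < n) (h : i + 1 < j ∨ j + 1 < i) :
    Tg n i * Tg n j = Tg n j * Tg n i := by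
  unfold Tg
  rcases h with h | h
  · have := RingQuot.mkAlgHom_rel HR (ARel.commT (n := n) i j h hj)
    simpa only [map_mul] using this
  · have := RingQuot.mkAlgHom_rel HR (ARel.commT (n := n) j i h hi)
    simpa only [map_mul] using this.symm

lemma sCol_comm (n i j : ℕ) (hi : i + 1 < n) (hj : j + 1 < n) (h : i + 1 < j ∨ j + 1 < i)
    (C : Finset (Fin n)) : sCol n i (sCol n j C) = sCol n j (sCol n i C) := by
  ext x
  simp only [mem_sCol]
  have : sgen n j (sgen n i x) = sgen n i (sgen n j x) := by
    ext
    simp only [sgen_val n i hi, sgen_val n j hj]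
    split_ifs <;> omega
  rw [this]

lemma mem_sCol_far (n i : ℕ) (hi : i + 1 < n) (C : Finset (Fin n)) (x : Fin n)
    (h1 : (x : ℕ) ≠ i) (h2 : (x : ℕ) ≠ i + 1) : x ∈ sCol n i C ↔ x ∈ C := by
  rw [mem_sCol]
  have : sgen n i x = x := by ext; rw [sgen_val n i hi]; simp [h1, h2]
  rw [this]

lemma good_card (n k : ℕ) (hk : k ≤ n) : ∀ (l : List ℕ) (C : Finset (Fin n)), Good n k l C →
    C.card = k := by
  intro l
  induction l with
  | nil => intro C h; rw [show C = hwCol n k from h, card_hwCol n k hk]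
  | cons i l ih =>
    rintro C ⟨h, h1, h2, hl⟩
    rw [← card_sCol n i C]; exact ih _ hl

lemma good_unique (n k : ℕ) (hk : k ≤ n) : ∀ (N : ℕ) (l m : List ℕ) (C : Finset (Fin n)),
    l.length = N → Good n k l C → Good n k m C → TofWord n l = TofWord n m := by
  intro N
  induction N with
  | zero =>
    intro l m C hN hl hm
    have a := (Good.props n k hk l C hl).2.2
    have b := (Good.props n k hk m C hm).2.2
    rw [List.length_eq_zero_iff.1 hN, List.length_eq_zero_iff.1 (show m.length = 0 by omega)]
  | succ N ih =>
    intro l m C hN hl hm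
    have a := (Good.props n k hk l C hl).2.2
    have b := (Good.props n k hk m C hm).2.2
    match l, m, hN, hl, hm with
    | i :: l, [], hN, hl, hm => simp at a b; omega
    | i :: l, j :: m, hN, hl, hm =>
      obtain ⟨hi, i1, i2, hl⟩ := hl
      obtain ⟨hj, j1, j2, hm⟩ := hm
      simp only [List.length_cons] at hN a b
      rw [TofWord_cons, TofWord_cons]
      by_cases hij : i = j
      · subst hij
        rw [ih l m _ (by omega) hl hm]
      · have hfar : i + 1 < j ∨ j + 1 < i := by
          have n1 : i + 1 ≠ j := by rintro rfl; exact j1 i2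
          have n2 : j + 1 ≠ i := by rintro rfl; exact i1 j2
          omega
        have hc : (sCol n j (sCol n i C)).card = k := by
          rw [card_sCol]; exact good_card n k hk _ _ hl
        obtain ⟨w, hw⟩ := exists_good n k hk _ _ rfl hc
        have g1 : Good n k (j :: w) (sCol n i C) := by
          refine ⟨hj, ?_, ?_, hw⟩
          · rw [mem_sCol_far n i hi _ _ (by simp; omega) (by simp; omega)]; exact j1
          · rw [mem_sCol_far n i hi _ _ (by simp; omega) (by simp; omega)]; exact j2
        have g2 : Good n k (i :: w) (sCol n j C) := by
          refine ⟨hi, ?_, ?_, ?_⟩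
          · rw [mem_sCol_far n j hj _ _ (by simp; omega) (by simp; omega)]; exact i1
          · rw [mem_sCol_far n j hj _ _ (by simp; omega) (by simp; omega)]; exact i2
          · rw [sCol_comm n i j hi hj hfar]; exact hw
        rw [ih l _ _ (by omega) hl g1, ih m _ _ (by omega) hm g2, TofWord_cons, TofWord_cons,
          ← mul_assoc, ← mul_assoc, Tg_comm n i j hi hj hfar]

/-- product over a list of the X's in C -/
def XL (n : ℕ) (C : Finset (Fin n)) (L : List (Fin n)) : H n :=
  (L.map fun x => if x ∈ C then Xg n x else 1).prod

lemma Xmon_vecOf (n : ℕ) (C : Finset (Fin n)) : Xmon n (vecOf n C) = XL n C (List.finRange n) := by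
  unfold Xmon XL
  rw [List.ofFn_eq_map]
  congr 2
  funext x
  unfold vecOf
  by_cases h : x ∈ C <;> simp [h]

lemma Xg_comm (n : ℕ) (i j : Fin n) : Xg n i * Xg n j = Xg n j * Xg n i := by
  have := RingQuot.mkAlgHom_rel HR (ARel.commX (n := n) i j)
  simp only [map_mul] at this
  exact this

lemma TX_comm (n i : ℕ) (h : i + 1 < n) (x : Fin n) (h1 : (x : ℕ) ≠ i) (h2 : (x : ℕ) ≠ i + 1) :
    Tg n i * Xg n x = Xg n x * Tg n i := by
  have := RingQuot.mkAlgHom_rel HR (ARel.TXcomm (n := n) i h x h1 h2)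
  simp only [map_mul] at this
  exact this

lemma TXT (n i : ℕ) (h : i + 1 < n) :
    Tg n i * Xg n ⟨i, by omega⟩ * Tg n i = tt • Xg n ⟨i + 1, h⟩ := by
  have := RingQuot.mkAlgHom_rel HR (ARel.TXT (n := n) i h)
  simp only [map_mul, map_smul] at this
  exact this

lemma XL_comm (n : ℕ) (C : Finset (Fin n)) (a : H n) (L : List (Fin n))
    (ha : ∀ x ∈ C, a * Xg n x = Xg n x * a) : a * XL n C L = XL n C L * a := by
  apply Commute.list_prod_right
  intro y hy
  rw [List.mem_map] at hy
  obtain ⟨x, _, rfl⟩ := hy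
  by_cases h : x ∈ C
  · simp only [h, if_true]; exact ha x h
  · simp [h]

lemma XL_insert (n : ℕ) (C : Finset (Fin n)) (x : Fin n) (hx : x ∉ C) : ∀ (L : List (Fin n)),
    L.Nodup → XL n (insert x C) L = if x ∈ L then Xg n x * XL n C L else XL n C L := by
  intro L
  induction L with
  | nil => intro _; simp [XL]
  | cons y L ih =>
    intro hL
    rw [List.nodup_cons] at hL
    have e : ∀ D, XL n D (y :: L) = (if y ∈ D then Xg n y else 1) * XL n D L := by
      intro D; simp [XL]
    rw [e, e, ih hL.2]
    by_cases hxy : y = x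
    · subst hxy
      simp [hx, hL.1]
    · have hxy' : ¬ x = y := fun h => hxy h.symm
      simp only [Finset.mem_insert, List.mem_cons, hxy, hxy', false_or]
      by_cases hy : y ∈ C <;> by_cases hxL : x ∈ L <;> simp only [hy, hxL, if_true, if_false, one_mul]
      rw [← mul_assoc, Xg_comm, mul_assoc]

lemma X_insert (n : ℕ) (C : Finset (Fin n)) (x : Fin n) (hx : x ∉ C) :
    Xmon n (vecOf n (insert x C)) = Xg n x * Xmon n (vecOf n C) := by
  rw [Xmon_vecOf, Xmon_vecOf, XL_insert n C x hx _ (List.nodup_finRange n)]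
  simp

lemma TXmonT (n i : ℕ) (h : i + 1 < n) (C : Finset (Fin n))
    (h1 : (⟨i, by omega⟩ : Fin n) ∉ C) (h2 : (⟨i + 1, h⟩ : Fin n) ∈ C) :
    Tg n i * Xmon n (vecOf n (sCol n i C)) * Tg n i = tt • Xmon n (vecOf n C) := by
  set a : Fin n := ⟨i, by omega⟩ with ha
  set b : Fin n := ⟨i + 1, h⟩ with hb
  have hab : a ≠ b := by simp [ha, hb]
  set K := C.erase b with hK
  have hbK : b ∉ K := by simp [hK]
  have haK : a ∉ K := by simp [hK, h1]
  have e1 : C = insert b K := (Finset.insert_erase h2).symm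
  have e2 : sCol n i C = insert a K := by
    ext x
    rw [Finset.mem_insert]
    by_cases x1 : x = a
    · subst x1; rw [mem_sCol, sgen_at n i h]; simp [← hb, h2]
    by_cases x2 : x = b
    · subst x2; rw [mem_sCol, sgen_at' n i h]; simp [← ha, h1, hbK, hab.symm]
    rw [mem_sCol_far n i h _ _ (fun e => x1 (Fin.ext e)) (fun e => x2 (Fin.ext e))]
    simp [hK, x1, x2]
  have e3 : Tg n i * Xmon n (vecOf n K) = Xmon n (vecOf n K) * Tg n i := by
    rw [Xmon_vecOf]
    apply XL_comm
    intro x hx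
    apply TX_comm n i h
    · intro e; apply haK; convert hx; exact Fin.ext e.symm
    · intro e; apply hbK; convert hx; exact Fin.ext e.symm
  rw [e2, X_insert n K a haK, mul_assoc, mul_assoc, ← e3, ← mul_assoc, ← mul_assoc,
    TXT n i h, smul_mul_assoc, ← X_insert n K b hbK, ← e1]

lemma good_identity (n k : ℕ) : ∀ (l : List ℕ) (C : Finset (Fin n)), Good n k l C →
    TofWord n l * Xmon n (vecOf n (hwCol n k)) * TofWord n l.reverse
      = tt ^ l.length • Xmon n (vecOf n C) := by
  intro l
  induction l with
  | nil => intro C h; rw [show C = hwCol n k from h]; simp [TofWord]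
  | cons i l ih =>
    rintro C ⟨h, h1, h2, hl⟩
    have e : TofWord n [i] = Tg n i := by simp [TofWord]
    rw [TofWord_cons, List.reverse_cons, TofWord_append, e]
    calc _ = Tg n i * (TofWord n l * Xmon n (vecOf n (hwCol n k)) * TofWord n l.reverse)
          * Tg n i := by simp only [mul_assoc]
      _ = _ := by
        rw [ih _ hl, mul_smul_comm, smul_mul_assoc, TXmonT n i h C h1 h2, smul_smul,
          List.length_cons, pow_succ]

lemma tt_unit : IsUnit tt := LaurentPolynomial.isUnit_T 1

lemma Tg_unit (n i : ℕ) : IsUnit (Tg n i) := by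
  by_cases h : i + 1 < n
  · have q := RingQuot.mkAlgHom_rel HR (ARel.quad (n := n) i h)
    simp only [map_mul, map_add, map_smul, AlgHom.commutes] at q
    change Tg n i * Tg n i = (tt - 1) • Tg n i + algebraMap HR (H n) tt at q
    have u : IsUnit (algebraMap HR (H n) tt) := tt_unit.map _
    have e1 : Tg n i * (Tg n i + algebraMap HR (H n) (1 - tt)) = algebraMap HR (H n) tt := by
      rw [mul_add, q, ← Algebra.commutes, ← Algebra.smul_def, add_right_comm, ← add_smul]
      rw [show tt - 1 + (1 - tt) = 0 by ring, zero_smul, zero_add]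
    have hc : Commute (Tg n i) (Tg n i + algebraMap HR (H n) (1 - tt)) :=
      (Commute.refl _).add_right (show _ * _ = _ * _ from (Algebra.commutes _ _).symm)
    rw [← e1] at u
    exact (hc.isUnit_mul_iff.1 u).1
  · have q := RingQuot.mkAlgHom_rel HR (ARel.junk (n := n) i h)
    rw [map_one] at q
    change Tg n i = 1 at q
    rw [q]; exact isUnit_one

lemma TofWord_unit (n : ℕ) (l : List ℕ) : IsUnit (TofWord n l) := by
  induction l with
  | nil => simp [TofWord]
  | cons i l ih => rw [TofWord_cons]; exact (Tg_unit n i).mul ih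


/-- for a column `I ∈ B(ϖ_k)`,
`T_{u_I} X^{ϖ_k} = X^{⃗I} t^{ℓ(u_I)} (T_{u_I⁻¹})⁻¹` in the affine Hecke algebra. -/
theorem stmt6 (n k : ℕ) (hn : 1 ≤ n) (hk1 : 1 ≤ k) (hkn : k ≤ n)
    (I : Finset (Fin n)) (hI : I.card = k) :
    Tw n (colPerm n I) * Xmon n (varpi n k)
      = Xmon n (vecOf n I) * (tpow n (len n (colPerm n I)) *
          Ring.inverse (Tw n (colPerm n I)⁻¹)) := by
  have hl := len_colPerm n k hkn I hI
  obtain ⟨g, hg⟩ := exists_good n k hkn _ I rfl hI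
  obtain ⟨p1, p2, -⟩ := Good.props n k hkn g I hg
  obtain ⟨a1, a2, a3⟩ := redWord_spec n (colPerm n I) ⟨g, p1, p2⟩
  obtain ⟨b1, b2, b3⟩ := redWord_spec n (colPerm n I)⁻¹
    ⟨g.reverse, by simpa using p1, by rw [wordProd_reverse, p2]⟩
  rw [len_inv] at b2
  have G1 : Good n k (redWord n (colPerm n I)) I :=
    good_of_word n k hkn I hI _ a1 a3 (by rw [a2, hl])
  have G2 : Good n k (redWord n (colPerm n I)⁻¹).reverse I :=
    good_of_word n k hkn I hI _ (by simpa using b1)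
      (by rw [wordProd_reverse, b3, inv_inv]) (by rw [List.length_reverse, b2, hl])
  have hU : IsUnit (Tw n (colPerm n I)⁻¹) := TofWord_unit n _
  have hv : varpi n k = vecOf n (hwCol n k) := by
    funext x; simp only [varpi, vecOf, mem_hwCol]
  have key := good_identity n k _ I G2
  rw [good_unique n k hkn _ _ _ I rfl G2 G1, List.reverse_reverse, List.length_reverse, b2,
    ← hv] at key
  change Tw n (colPerm n I) * _ * Tw n (colPerm n I)⁻¹ = _ at key
  apply hU.mul_right_cancel
  rw [key, mul_assoc, mul_assoc, Ring.inverse_mul_cancel _ hU, mul_one, tpow,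
    ← Algebra.commutes, ← Algebra.smul_def]

end HLHecke
end
end
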